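/- Under the Gaussian box-decomposition setup, for all m ≠ m', the mixed restricted standardized second moment satisfies ∫ (ȳ m)·(ȳ m')·1_{f ∈ D} dP = ρ m · ρ m' · Σ_{j=1}^J W[j] · (G[j,m]/W[j,m]) · (G[j,m']/W[j,m']). -/

import Mathlib

open MeasureTheory ProbabilityTheory

noncomputable section

/-- The density of the standard normal distribution. -/
def stdPdf (z : ℝ) : ℝ := (Real.sqrt (2 * Real.pi))⁻¹ * Real.exp (-z ^ 2 / 2)

/-- The cumulative distribution function of the standard normal distribution. -/
def stdCdf (x : ℝ) : ℝ := ∫ z in Set.Iic x, stdPdf z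

/-- The standardization map `γ m c = (c − μ m)/√(s m)`. -/
def gam {M : ℕ} (μ s : Fin M → ℝ) (m : Fin M) (c : ℝ) : ℝ :=
  (c - μ m) / Real.sqrt (s m)

/-- `W[j,m] = Φ(γ m (u j m)) − Φ(γ m (l j m))`. -/
def Wjm {M J : ℕ} (μ s : Fin M → ℝ) (l u : Fin J → Fin M → ℝ) (j : Fin J) (m : Fin M) : ℝ :=
  stdCdf (gam μ s m (u j m)) - stdCdf (gam μ s m (l j m))

/-- `W[j] = ∏_m W[j,m]`. -/
def Wj {M J : ℕ} (μ s : Fin M → ℝ) (l u : Fin J → Fin M → ℝ) (j : Fin J) : ℝ :=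
  ∏ m, Wjm μ s l u j m

/-- `W = Σ_j W[j]`. -/
def Wtot {M J : ℕ} (μ s : Fin M → ℝ) (l u : Fin J → Fin M → ℝ) : ℝ :=
  ∑ j, Wj μ s l u j

/-- `G[j,m] = φ(γ m (u j m)) − φ(γ m (l j m))`. -/
def Gjm {M J : ℕ} (μ s : Fin M → ℝ) (l u : Fin J → Fin M → ℝ) (j : Fin J) (m : Fin M) : ℝ :=
  stdPdf (gam μ s m (u j m)) - stdPdf (gam μ s m (l j m))

/-- `V[j,m] = γ m (u j m)·φ(γ m (u j m)) − γ m (l j m)·φ(γ m (l j m))`. -/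
def Vjm {M J : ℕ} (μ s : Fin M → ℝ) (l u : Fin J → Fin M → ℝ) (j : Fin J) (m : Fin M) : ℝ :=
  gam μ s m (u j m) * stdPdf (gam μ s m (u j m))
    - gam μ s m (l j m) * stdPdf (gam μ s m (l j m))

/-- `ρ m = √(s m / (s m + σ m))`. -/
def rho {M : ℕ} (s σ : Fin M → ℝ) (m : Fin M) : ℝ := Real.sqrt (s m / (s m + σ m))

/-- The union `D = ⋃_j B j` of the boxes `B j`. -/
def boxD {M J : ℕ} (l u : Fin J → Fin M → ℝ) : Set (Fin M → ℝ) :=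
  ⋃ j, {z : Fin M → ℝ | ∀ m, l j m < z m ∧ z m ≤ u j m}

/-- The joint law of `(f, ε)`: the product of the two product Gaussian measures
`⨂_m N(μ m, s m)` and `⨂_m N(0, σ m)`. -/
def Pmeas {M : ℕ} (μ s σ : Fin M → ℝ) : Measure ((Fin M → ℝ) × (Fin M → ℝ)) :=
  (Measure.pi fun m => gaussianReal (μ m) (s m).toNNReal).prod
    (Measure.pi fun m => gaussianReal 0 (σ m).toNNReal)

end

lemma stdPdf_pos (z : ℝ) : 0 < stdPdf z := by
  unfold stdPdf
  positivity

lemma continuous_stdPdf : Continuous stdPdf := by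
  unfold stdPdf
  fun_prop

lemma integrable_stdPdf : Integrable stdPdf := by
  refine (integrable_gaussianPDFReal 0 1).congr (Filter.Eventually.of_forall fun z => ?_)
  simp [stdPdf, gaussianPDFReal]

lemma hasDerivAt_stdPdf (z : ℝ) : HasDerivAt stdPdf (-(stdPdf z * z)) z := by
  have h : HasDerivAt (fun z : ℝ => -z ^ 2 / 2) (-z) z := by
    refine (((hasDerivAt_id z).pow 2).neg.div_const 2).congr_deriv ?_
    simp
    ring
  refine (h.exp.const_mul (Real.sqrt (2 * Real.pi))⁻¹).congr_deriv ?_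
  simp only [stdPdf]
  ring

lemma integral_stdPdf (a b : ℝ) : ∫ z in a..b, stdPdf z = stdCdf b - stdCdf a :=
  (intervalIntegral.integral_Iic_sub_Iic integrable_stdPdf.integrableOn
    integrable_stdPdf.integrableOn).symm

lemma integral_stdPdf_mul_id (a b : ℝ) :
    ∫ z in a..b, stdPdf z * z = -(stdPdf b - stdPdf a) := by
  rw [intervalIntegral.integral_eq_sub_of_hasDerivAt (f := -stdPdf)
    (f' := fun z => stdPdf z * z)
    (fun z _ => by simpa using (hasDerivAt_stdPdf z).neg)
    ((continuous_stdPdf.mul continuous_id').intervalIntegrable _ _)]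
  simp only [Pi.neg_apply]
  ring

lemma gaussianPDFReal_eq_stdPdf (c x : ℝ) {v : ℝ} (hv : 0 < v) :
    gaussianPDFReal c v.toNNReal x = (Real.sqrt v)⁻¹ * stdPdf ((x - c) / Real.sqrt v) := by
  have h : -((x - c) / Real.sqrt v) ^ 2 / 2 = -(x - c) ^ 2 / (2 * v) := by
    rw [div_pow, Real.sq_sqrt hv.le]
    field_simp
  rw [gaussianPDFReal, stdPdf, h, Real.coe_toNNReal v hv.le,
    Real.sqrt_mul (by positivity : (0 : ℝ) ≤ 2 * Real.pi), mul_inv]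
  ring

/-- Standardization of a Gaussian integral restricted to a half-open interval. -/
lemma integral_gaussianReal_indicator_Ioc (c : ℝ) {v : ℝ} (hv : 0 < v) {a b : ℝ} (hab : a ≤ b)
    (g : ℝ → ℝ) :
    ∫ x, g ((x - c) / Real.sqrt v) * Set.indicator (Set.Ioc a b) (fun _ => (1 : ℝ)) x
        ∂(gaussianReal c v.toNNReal)
      = ∫ z in ((a - c) / Real.sqrt v)..((b - c) / Real.sqrt v), stdPdf z * g z := by
  have hv' : Real.sqrt v ≠ 0 := (Real.sqrt_pos.2 hv).ne'
  rw [integral_gaussianReal_eq_integral_smul (by simpa using hv)]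
  calc
    _ = ∫ x, Set.indicator (Set.Ioc a b) (fun x => (Real.sqrt v)⁻¹ *
          (stdPdf (x / Real.sqrt v - c / Real.sqrt v)
            * g (x / Real.sqrt v - c / Real.sqrt v))) x := by
      refine integral_congr_ae (Filter.Eventually.of_forall fun x => ?_)
      simp only [gaussianPDFReal_eq_stdPdf c x hv, smul_eq_mul, Set.indicator_apply, ← sub_div]
      split_ifs <;> ring
    _ = _ := by
      rw [integral_indicator measurableSet_Ioc, ← intervalIntegral.integral_of_le hab,
        intervalIntegral.integral_const_mul,
        intervalIntegral.integral_comp_div_sub (fun z => stdPdf z * g z) hv',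
        smul_eq_mul, inv_mul_cancel_left₀ hv', sub_div, sub_div]

section OneDimensional

variable (c : ℝ) {v w : ℝ} (a b : ℝ)

lemma integrable_indicator_Ioc :
    Integrable (Set.indicator (Set.Ioc a b) (fun _ => (1 : ℝ))) (gaussianReal c v.toNNReal) :=
  (integrable_const 1).indicator measurableSet_Ioc

lemma integrable_mul_indicator_Ioc :
    Integrable (fun x => (x - c) * Set.indicator (Set.Ioc a b) (fun _ => (1 : ℝ)) x)
      (gaussianReal c v.toNNReal) := by
  have h : Integrable (fun x => x - c) (gaussianReal c v.toNNReal) :=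
    ((memLp_id_gaussianReal 1).integrable le_rfl).sub (integrable_const c)
  refine (h.indicator (measurableSet_Ioc (a := a) (b := b))).congr
    (Filter.Eventually.of_forall fun x => ?_)
  simp only [Set.indicator_apply]
  split_ifs <;> simp

lemma integrable_noise_indicator_Ioc :
    Integrable (fun p : ℝ × ℝ => Set.indicator (Set.Ioc a b) (fun _ => (1 : ℝ)) p.1)
      ((gaussianReal c v.toNNReal).prod (gaussianReal 0 w.toNNReal)) :=
  (integrable_indicator_Ioc c a b).comp_fst _

lemma integral_noise_indicator_Ioc (hv : 0 < v) (hab : a ≤ b) :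
    ∫ p : ℝ × ℝ, Set.indicator (Set.Ioc a b) (fun _ => (1 : ℝ)) p.1
        ∂((gaussianReal c v.toNNReal).prod (gaussianReal 0 w.toNNReal))
      = stdCdf ((b - c) / Real.sqrt v) - stdCdf ((a - c) / Real.sqrt v) := by
  rw [integral_fun_fst (Set.indicator (Set.Ioc a b) (fun _ => (1 : ℝ))), ← integral_stdPdf]
  simpa using integral_gaussianReal_indicator_Ioc c hv hab (fun _ => 1)

lemma noisy_moment_eq (p : ℝ × ℝ) :
    (p.1 + p.2 - c) / Real.sqrt (v + w) * Set.indicator (Set.Ioc a b) (fun _ => (1 : ℝ)) p.1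
      = (Real.sqrt (v + w))⁻¹
          * ((p.1 - c) * Set.indicator (Set.Ioc a b) (fun _ => (1 : ℝ)) p.1
            + Set.indicator (Set.Ioc a b) (fun _ => (1 : ℝ)) p.1 * p.2) := by
  ring

lemma integrable_indicator_mul_noise :
    Integrable (fun p : ℝ × ℝ => Set.indicator (Set.Ioc a b) (fun _ => (1 : ℝ)) p.1 * p.2)
      ((gaussianReal c v.toNNReal).prod (gaussianReal 0 w.toNNReal)) :=
  (integrable_indicator_Ioc c a b).mul_prod ((memLp_id_gaussianReal 1).integrable le_rfl)

lemma integrable_noisy_moment :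
    Integrable (fun p : ℝ × ℝ => (p.1 + p.2 - c) / Real.sqrt (v + w)
        * Set.indicator (Set.Ioc a b) (fun _ => (1 : ℝ)) p.1)
      ((gaussianReal c v.toNNReal).prod (gaussianReal 0 w.toNNReal)) := by
  simp only [noisy_moment_eq]
  exact (((integrable_mul_indicator_Ioc c a b).comp_fst _).add
    (integrable_indicator_mul_noise c a b)).const_mul _

lemma integral_noisy_moment (hv : 0 < v) (hab : a ≤ b) :
    ∫ p : ℝ × ℝ, (p.1 + p.2 - c) / Real.sqrt (v + w)
        * Set.indicator (Set.Ioc a b) (fun _ => (1 : ℝ)) p.1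
        ∂((gaussianReal c v.toNNReal).prod (gaussianReal 0 w.toNNReal))
      = -(Real.sqrt (v / (v + w))
          * (stdPdf ((b - c) / Real.sqrt v) - stdPdf ((a - c) / Real.sqrt v))) := by
  have hv' : Real.sqrt v ≠ 0 := (Real.sqrt_pos.2 hv).ne'
  have hsignal : ∫ x, (x - c) * Set.indicator (Set.Ioc a b) (fun _ => (1 : ℝ)) x
        ∂(gaussianReal c v.toNNReal)
      = -(Real.sqrt v
          * (stdPdf ((b - c) / Real.sqrt v) - stdPdf ((a - c) / Real.sqrt v))) := by
    rw [← mul_neg, ← integral_stdPdf_mul_id,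
      ← integral_gaussianReal_indicator_Ioc c hv hab (fun z => z), ← integral_const_mul]
    refine integral_congr_ae (Filter.Eventually.of_forall fun x => ?_)
    field_simp
  simp only [noisy_moment_eq]
  rw [integral_const_mul,
    integral_add ((integrable_mul_indicator_Ioc c a b).comp_fst _)
      (integrable_indicator_mul_noise c a b),
    integral_fun_fst (fun x => (x - c) * Set.indicator (Set.Ioc a b) (fun _ => (1 : ℝ)) x),
    integral_prod_mul (Set.indicator (Set.Ioc a b) (fun _ => (1 : ℝ))) (fun e : ℝ => e),
    integral_id_gaussianReal, hsignal, Real.sqrt_div hv.le]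
  simp
  ring

end OneDimensional

lemma Wjm_pos {M J : ℕ} {μ s : Fin M → ℝ} {l u : Fin J → Fin M → ℝ} {j : Fin J} {m : Fin M}
    (hs : 0 < s m) (hlu : l j m < u j m) : 0 < Wjm μ s l u j m := by
  rw [Wjm, ← integral_stdPdf]
  refine intervalIntegral.intervalIntegral_pos_of_pos
    (continuous_stdPdf.intervalIntegrable _ _) stdPdf_pos ?_
  exact div_lt_div_of_pos_right (sub_lt_sub_right hlu _) (Real.sqrt_pos.2 hs)

/-- Distributing two marked factors over a product. -/
lemma prod_marked {ι : Type*} [Fintype ι] [DecidableEq ι] (i k : ι) (y w : ι → ℝ) :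
    ∏ n, (if n = i then y n else 1) * (if n = k then y n else 1) * w n = y i * y k * ∏ n, w n := by
  rw [Finset.prod_mul_distrib, Finset.prod_mul_distrib]
  simp

/-- The factor of coordinate `k` in the integrand for box `j`. -/
noncomputable def boxFactor {M J : ℕ} (μ s σ : Fin M → ℝ) (l u : Fin J → Fin M → ℝ) (m m' : Fin M)
    (j : Fin J) (k : Fin M) (q : ℝ × ℝ) : ℝ :=
  (if k = m then (q.1 + q.2 - μ k) / Real.sqrt (s k + σ k) else 1)
    * (if k = m' then (q.1 + q.2 - μ k) / Real.sqrt (s k + σ k) else 1)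
    * Set.indicator (Set.Ioc (l j k) (u j k)) (fun _ => (1 : ℝ)) q.1

section BoxFactor

variable {M J : ℕ} {μ s σ : Fin M → ℝ} {l u : Fin J → Fin M → ℝ} {m m' : Fin M}

lemma integrable_boxFactor (hmm' : m ≠ m') (j : Fin J) (k : Fin M) :
    Integrable (boxFactor μ s σ l u m m' j k)
      ((gaussianReal (μ k) (s k).toNNReal).prod (gaussianReal 0 (σ k).toNNReal)) := by
  unfold boxFactor
  by_cases h : k = m
  · simpa [h, hmm'] using integrable_noisy_moment (μ m) (v := s m) (w := σ m) (l j m) (u j m)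
  · by_cases h' : k = m'
    · simpa [h', hmm'.symm] using
        integrable_noisy_moment (μ m') (v := s m') (w := σ m') (l j m') (u j m')
    · simpa [h, h'] using
        integrable_noise_indicator_Ioc (μ k) (v := s k) (w := σ k) (l j k) (u j k)

lemma integral_boxFactor (hs : ∀ m, 0 < s m) (hlu : ∀ j m, l j m < u j m) (hmm' : m ≠ m')
    (j : Fin J) (k : Fin M) :
    ∫ q, boxFactor μ s σ l u m m' j k q
        ∂((gaussianReal (μ k) (s k).toNNReal).prod (gaussianReal 0 (σ k).toNNReal))
      = (if k = m then -(rho s σ k * (Gjm μ s l u j k / Wjm μ s l u j k)) else 1)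
        * (if k = m' then -(rho s σ k * (Gjm μ s l u j k / Wjm μ s l u j k)) else 1)
        * Wjm μ s l u j k := by
  have hW : Wjm μ s l u j k ≠ 0 := (Wjm_pos (hs k) (hlu j k)).ne'
  have hmoment := integral_noisy_moment (μ k) (w := σ k) (l j k) (u j k) (hs k) (hlu j k).le
  have hrho : -(rho s σ k * (Gjm μ s l u j k / Wjm μ s l u j k)) * Wjm μ s l u j k
      = -(rho s σ k * Gjm μ s l u j k) := by
    field_simp
  unfold boxFactor
  by_cases h : k = m
  · have h' : k ≠ m' := h ▸ hmm'
    simp only [if_pos h, if_neg h', mul_one, hrho]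
    exact hmoment
  · by_cases h' : k = m'
    · simp only [if_neg h, if_pos h', one_mul, hrho]
      exact hmoment
    · simp only [if_neg h, if_neg h', one_mul]
      exact integral_noise_indicator_Ioc (μ k) (l j k) (u j k) (hs k) (hlu j k).le

lemma measurePreserving_Pmeas :
    MeasurePreserving (MeasurableEquiv.arrowProdEquivProdArrow ℝ ℝ (Fin M))
      (Measure.pi fun k =>
        (gaussianReal (μ k) (s k).toNNReal).prod (gaussianReal 0 (σ k).toNNReal))
      (Pmeas μ s σ) :=
  measurePreserving_arrowProdEquivProdArrow _ _ _ _ _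

lemma integrable_prod_boxFactor (hmm' : m ≠ m') (j : Fin J) :
    Integrable (fun p : (Fin M → ℝ) × (Fin M → ℝ) =>
      ∏ k, boxFactor μ s σ l u m m' j k (p.1 k, p.2 k)) (Pmeas μ s σ) := by
  rw [← measurePreserving_Pmeas.integrable_comp_emb (MeasurableEquiv.measurableEmbedding _)]
  exact Integrable.fintype_prod fun k => integrable_boxFactor hmm' j k

lemma integral_prod_boxFactor (hs : ∀ m, 0 < s m) (hlu : ∀ j m, l j m < u j m) (hmm' : m ≠ m')
    (j : Fin J) :
    ∫ p, ∏ k, boxFactor μ s σ l u m m' j k (p.1 k, p.2 k) ∂(Pmeas μ s σ)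
      = rho s σ m * rho s σ m' * (Wj μ s l u j * (Gjm μ s l u j m / Wjm μ s l u j m)
              * (Gjm μ s l u j m' / Wjm μ s l u j m')) := by
  rw [← measurePreserving_Pmeas.integral_comp']
  refine (integral_fintype_prod_eq_prod (boxFactor μ s σ l u m m' j)).trans ?_
  simp only [integral_boxFactor hs hlu hmm']
  rw [prod_marked, Wj]
  ring

end BoxFactor

/-- The indicator of a box is the product of the indicators of its sides. -/
lemma indicator_box {M : ℕ} (a b z : Fin M → ℝ) :
    Set.indicator {z : Fin M → ℝ | ∀ m, a m < z m ∧ z m ≤ b m} (fun _ => (1 : ℝ)) z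
      = ∏ k, Set.indicator (Set.Ioc (a k) (b k)) (fun _ => (1 : ℝ)) (z k) := by
  classical
  simp [Set.indicator_apply, Finset.prod_boole]


/-- Mixed restricted standardized second moment for `m ≠ m'`. -/
theorem mixed_restricted_standardized_second_moment
    (M J : ℕ) (hM : 1 ≤ M) (hJ : 1 ≤ J)
    (μ s σ : Fin M → ℝ) (hs : ∀ m, 0 < s m) (hσ : ∀ m, 0 ≤ σ m)
    (l u : Fin J → Fin M → ℝ) (hlu : ∀ j m, l j m < u j m)
    (hdisj : Pairwise fun j j' : Fin J => Disjoint
        {z : Fin M → ℝ | ∀ m, l j m < z m ∧ z m ≤ u j m}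
        {z : Fin M → ℝ | ∀ m, l j' m < z m ∧ z m ≤ u j' m})
    (m m' : Fin M) (hmm' : m ≠ m') :
    ∫ p, ((p.1 m + p.2 m - μ m) / Real.sqrt (s m + σ m))
        * ((p.1 m' + p.2 m' - μ m') / Real.sqrt (s m' + σ m'))
        * Set.indicator (boxD l u) (fun _ => (1 : ℝ)) p.1 ∂(Pmeas μ s σ)
      = rho s σ m * rho s σ m'
          * ∑ j, Wj μ s l u j * (Gjm μ s l u j m / Wjm μ s l u j m)
              * (Gjm μ s l u j m' / Wjm μ s l u j m') := by
  have hind (z : Fin M → ℝ) : Set.indicator (boxD l u) (fun _ => (1 : ℝ)) z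
      = ∑ j, ∏ k, Set.indicator (Set.Ioc (l j k) (u j k)) (fun _ => (1 : ℝ)) (z k) := by
    simp only [← indicator_box]
    rw [← Finset.indicator_biUnion_apply _ _ fun i _ j _ hij => hdisj hij]
    simp [boxD]
  calc
    _ = ∫ p, ∑ j, ∏ k, boxFactor μ s σ l u m m' j k (p.1 k, p.2 k) ∂(Pmeas μ s σ) := by
      refine integral_congr_ae (Filter.Eventually.of_forall fun p => ?_)
      simp only [hind, Finset.mul_sum, boxFactor]
      refine Finset.sum_congr rfl fun j _ => ?_
      exact (prod_marked m m' (fun k => (p.1 k + p.2 k - μ k) / Real.sqrt (s k + σ k)) _).symm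
    _ = _ := by
      rw [integral_finsetSum _ fun j _ => integrable_prod_boxFactor hmm' j, Finset.mul_sum]
      exact Finset.sum_congr rfl fun j _ => integral_prod_boxFactor hs hlu hmm' j
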